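/- Let a, b, c be complex numbers with Re(c−a−b) > 0 and c not a nonpositive integer. Then the Gauss hypergeometric function satisfies ₂F₁(a, b, c; 1) = Γ(c)Γ(c−a−b) / (Γ(c−a)Γ(c−b)). -/

import Mathlib

open Complex

namespace GaussAux
open Filter Topology

noncomputable def P (s : ℂ) (n : ℕ) : ℂ := (ascPochhammer ℂ n).eval s

lemma P_succ (s : ℂ) (n : ℕ) : P s (n+1) = P s n * (s + n) := by
  simp [P, ascPochhammer_succ_eval]

lemma P_zero (s : ℂ) : P s 0 = 1 := by simp [P]

lemma P_prod (s : ℂ) (n : ℕ) : P s n = ∏ j ∈ Finset.range n, (s + j) := by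
  induction n with
  | zero => simp [P_zero]
  | succ n ih => rw [P_succ, ih, Finset.prod_range_succ]

lemma P_ne {c : ℂ} (hc : ∀ n : ℕ, c ≠ -(n : ℂ)) (n : ℕ) : P c n ≠ 0 := by
  rw [P_prod, Finset.prod_ne_zero_iff]
  intro j _ h
  exact hc j (eq_neg_of_add_eq_zero_left h)

lemma P_shift (c : ℂ) (n : ℕ) : c * P (c+1) n = P c n * (c + n) := by
  induction n with
  | zero => simp [P_zero]
  | succ n ih =>
    rw [P_succ, P_succ, ← mul_assoc, ih]; push_cast; ring

lemma P_eq_zero (m n : ℕ) (h : m < n) : P (-(m:ℂ)) n = 0 := by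
  rw [P_prod]
  exact Finset.prod_eq_zero (Finset.mem_range.2 h) (by simp)

lemma seq_eq (s : ℂ) (n : ℕ) : GammaSeq s n = (n:ℂ)^s * n.factorial / P s (n+1) := by
  rw [P_prod]; rfl

lemma bound_above (s : ℂ) : ∃ C : ℝ, 0 < C ∧ ∀ᶠ n : ℕ in atTop,
    ‖P s (n+1)‖ ≤ C * ((n:ℝ)^s.re * n.factorial) := by
  by_cases h : ∀ m : ℕ, s ≠ -(m:ℂ)
  · have h1 := (GammaSeq_tendsto_Gamma s).inv₀ (Gamma_ne_zero h)
    have h2 := h1.norm.eventually (gt_mem_nhds (lt_add_one _))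
    refine ⟨‖(Gamma s)⁻¹‖ + 1, by positivity, ?_⟩
    filter_upwards [h2, eventually_gt_atTop 0] with n hn hn0
    rw [seq_eq, inv_div, norm_div, norm_mul, norm_natCast_cpow_of_pos hn0, norm_natCast] at hn
    have : (0:ℝ) < (n:ℝ)^s.re * n.factorial := by positivity
    exact ((div_lt_iff₀ this).1 hn).le
  · push Not at h
    obtain ⟨m, rfl⟩ := h
    refine ⟨1, one_pos, ?_⟩
    filter_upwards [eventually_ge_atTop m] with n hn
    rw [P_eq_zero m (n+1) (by omega), norm_zero]
    positivity

lemma bound_below {c : ℂ} (hc : ∀ n : ℕ, c ≠ -(n : ℂ)) : ∃ C : ℝ, 0 < C ∧ ∀ᶠ n : ℕ in atTop,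
    (n:ℝ)^c.re * n.factorial ≤ C * ‖P c (n+1)‖ := by
  have h2 := (GammaSeq_tendsto_Gamma c).norm.eventually (gt_mem_nhds (lt_add_one _))
  refine ⟨‖Gamma c‖ + 1, by positivity, ?_⟩
  filter_upwards [h2, eventually_gt_atTop 0] with n hn hn0
  rw [seq_eq, norm_div, norm_mul, norm_natCast_cpow_of_pos hn0, norm_natCast] at hn
  exact ((div_lt_iff₀ (norm_pos_iff.2 (P_ne hc _))).1 hn).le

noncomputable def t (a b c : ℂ) (n : ℕ) : ℂ := (P a n * P b n / P c n) / (n.factorial : ℂ)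

lemma t_bound (a b : ℂ) {c : ℂ} (hc : ∀ n : ℕ, c ≠ -(n : ℂ)) : ∃ C : ℝ, 0 < C ∧
    ∀ᶠ n : ℕ in atTop, ‖((n+1 : ℕ) : ℂ) * t a b c (n+1)‖ ≤ C * (n:ℝ)^(-(c-a-b).re) := by
  obtain ⟨A, hA, h1⟩ := bound_above a
  obtain ⟨B, hB, h2⟩ := bound_above b
  obtain ⟨D, hD, h3⟩ := bound_below hc
  refine ⟨A * B * D, by positivity, ?_⟩
  filter_upwards [h1, h2, h3, eventually_gt_atTop 0] with n h1 h2 h3 hn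
  have hn' : (0:ℝ) < n := by exact_mod_cast hn
  have hp : 0 < ‖P c (n+1)‖ := norm_pos_iff.2 (P_ne hc _)
  have hf : (0:ℝ) < n.factorial := by positivity
  have e : ‖((n+1 : ℕ) : ℂ) * t a b c (n+1)‖
      = ‖P a (n+1)‖ * ‖P b (n+1)‖ / (‖P c (n+1)‖ * n.factorial) := by
    rw [t, norm_mul, norm_div, norm_div, norm_mul, norm_natCast, norm_natCast, Nat.factorial_succ]
    push_cast
    have : (n:ℝ) + 1 ≠ 0 := by positivity
    field_simp
  rw [e, div_le_iff₀ (by positivity)]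
  have e2 : (n:ℝ)^(-(c-a-b).re) * (n:ℝ)^c.re = (n:ℝ)^a.re * (n:ℝ)^b.re := by
    rw [← Real.rpow_add hn', ← Real.rpow_add hn']; congr 1; simp; ring
  calc ‖P a (n+1)‖ * ‖P b (n+1)‖
      ≤ (A * ((n:ℝ)^a.re * n.factorial)) * (B * ((n:ℝ)^b.re * n.factorial)) := by gcongr
    _ = A * B * (n:ℝ)^(-(c-a-b).re) * n.factorial * ((n:ℝ)^c.re * n.factorial) := by
        linear_combination (-(A * B * (n.factorial:ℝ)^2)) * e2
    _ ≤ A * B * (n:ℝ)^(-(c-a-b).re) * n.factorial * (D * ‖P c (n+1)‖) := by gcongr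
    _ = _ := by ring

lemma t_summable {a b c : ℂ} (hc : ∀ n : ℕ, c ≠ -(n : ℂ)) (h : 0 < (c-a-b).re) :
    Summable (t a b c) := by
  obtain ⟨C, hC, hb⟩ := t_bound a b hc
  rw [← summable_nat_add_iff 1]
  have hs : Summable (fun n : ℕ => C * (n:ℝ)^(-(c-a-b).re - 1)) :=
    (Real.summable_nat_rpow.2 (by linarith)).mul_left C
  refine Summable.of_norm_bounded_eventually_nat hs ?_
  filter_upwards [hb, eventually_gt_atTop 0] with n hb hn
  have hn' : (0:ℝ) < n := by exact_mod_cast hn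
  rw [Real.rpow_sub_one hn'.ne', mul_div_assoc', le_div_iff₀ hn']
  refine le_trans ?_ hb
  rw [norm_mul, norm_natCast, mul_comm]
  gcongr
  simp

lemma nt_tendsto {a b c : ℂ} (hc : ∀ n : ℕ, c ≠ -(n : ℂ)) (h : 0 < (c-a-b).re) :
    Tendsto (fun n : ℕ => (n:ℂ) * t a b c n) atTop (𝓝 0) := by
  obtain ⟨C, hC, hb⟩ := t_bound a b hc
  rw [← tendsto_add_atTop_iff_nat 1]
  refine squeeze_zero_norm' hb ?_
  simpa using ((tendsto_rpow_neg_atTop h).comp tendsto_natCast_atTop_atTop).const_mul C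

lemma hc_succ {c : ℂ} (hc : ∀ n : ℕ, c ≠ -(n : ℂ)) (N : ℕ) : ∀ n : ℕ, c + N ≠ -(n : ℂ) := by
  intro n h
  apply hc (n + N)
  push_cast
  linear_combination h

lemma t_rec (a b : ℂ) {c : ℂ} (hc : ∀ n : ℕ, c ≠ -(n : ℂ)) (n : ℕ) :
    (c-a)*(c-b)*t a b (c+1) n - c*(c-a-b)*t a b c n
      = c * (((n+1:ℕ):ℂ) * t a b c (n+1)) - c * ((n:ℂ) * t a b c n) := by
  have h0 : c ≠ 0 := by simpa using hc 0
  have hn : c + n ≠ 0 := by simpa using hc_succ hc n 0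
  have hP := P_ne hc n
  have hf : (n.factorial : ℂ) ≠ 0 := by exact_mod_cast n.factorial_ne_zero
  have hn1 : (n:ℂ) + 1 ≠ 0 := by exact_mod_cast n.succ_ne_zero
  have e : P (c+1) n = P c n * (c+n) / c := by
    rw [eq_div_iff h0, ← P_shift]; ring
  simp only [t, e, P_succ, Nat.factorial_succ]
  push_cast
  field_simp
  ring

lemma F_rec {a b c : ℂ} (hc : ∀ n : ℕ, c ≠ -(n : ℂ)) (h : 0 < (c-a-b).re) :
    c*(c-a-b) * ∑' n, t a b c n = (c-a)*(c-b) * ∑' n, t a b (c+1) n := by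
  have s1 := t_summable hc h
  have s2 : Summable (t a b (c+1)) := by
    refine t_summable (by simpa using hc_succ hc 1) ?_
    simp at h ⊢; linarith
  have hs := ((s2.hasSum.mul_left ((c-a)*(c-b))).sub (s1.hasSum.mul_left (c*(c-a-b)))).tendsto_sum_nat
  simp only [t_rec a b hc] at hs
  have e : ∀ N, ∑ n ∈ Finset.range N, (c * (((n+1:ℕ):ℂ) * t a b c (n+1)) - c * ((n:ℂ) * t a b c n))
      = c * ((N:ℂ) * t a b c N) := by
    intro N
    rw [Finset.sum_range_sub (fun n => c * ((n:ℂ) * t a b c n))]; simp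
  simp only [e] at hs
  have := tendsto_nhds_unique hs ((nt_tendsto hc h).const_mul c)
  linear_combination -this

lemma F_iter {a b c : ℂ} (hc : ∀ n : ℕ, c ≠ -(n : ℂ)) (h : 0 < (c-a-b).re) (N : ℕ) :
    P c N * P (c-a-b) N * ∑' n, t a b c n = P (c-a) N * P (c-b) N * ∑' n, t a b (c+N) n := by
  induction N with
  | zero => simp [P_zero]
  | succ N ih =>
    have := F_rec (a := a) (b := b) (hc_succ hc N) (by simp at h ⊢; linarith [Nat.cast_nonneg (α := ℝ) N])
    simp only [P_succ]
    push_cast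
    rw [← add_assoc c]
    linear_combination (c+N)*(c-a-b+N) * ih + P (c-a) N * P (c-b) N * this

lemma F_lim {a b c : ℂ} (hc : ∀ n : ℕ, c ≠ -(n : ℂ)) (h : 0 < (c-a-b).re) :
    Tendsto (fun N : ℕ => ∑' n, t a b (c+N) n) atTop (𝓝 1) := by
  obtain ⟨N₀, hN₀⟩ := exists_nat_gt (-c.re)
  have key := tendsto_tsum_of_dominated_convergence (𝓕 := atTop)
    (f := fun (N : ℕ) n => t a b (c+N) n) (g := fun n => if n = 0 then (1:ℂ) else 0)
    (bound := fun n => ‖t a b (c+N₀) n‖) ?_ ?_ ?_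
  · simpa using key
  · exact (t_summable (hc_succ hc N₀)
      (by simp at h ⊢; linarith [Nat.cast_nonneg (α := ℝ) N₀])).norm
  · intro n
    rcases Nat.eq_zero_or_pos n with rfl | hn
    · simp [t, P_zero]
    · simp only [hn.ne', if_false]
      have h1 : Tendsto (fun N : ℕ => ‖c + N‖) atTop atTop := by
        refine tendsto_atTop_mono (f := fun N : ℕ => (c.re + (N:ℝ))) ?_ ?_
        · intro N
          simpa using Complex.re_le_norm (c + N)
        · exact tendsto_atTop_add_const_left _ _ tendsto_natCast_atTop_atTop
      have h2 : Tendsto (fun N : ℕ => ‖P (c+N) n‖) atTop atTop :=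
        Polynomial.tendsto_norm_atTop (ascPochhammer ℂ n) (by
          rw [← Polynomial.natDegree_pos_iff_degree_pos, ascPochhammer_natDegree]; exact hn) h1
      have h3 : Tendsto (fun N : ℕ => (P (c+N) n)⁻¹) atTop (𝓝 0) := by
        rw [tendsto_zero_iff_norm_tendsto_zero]
        simp only [norm_inv]
        exact h2.inv_tendsto_atTop
      have h4 := h3.const_mul (P a n * P b n / n.factorial)
      rw [mul_zero] at h4
      refine h4.congr fun N => ?_
      simp only [t]; ring
  · filter_upwards [eventually_ge_atTop N₀] with N hN n
    simp only [t, norm_div]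
    have hpos : 0 < ‖P (c+N₀) n‖ := norm_pos_iff.2 (P_ne (hc_succ hc N₀) n)
    have hle : ‖P (c+N₀) n‖ ≤ ‖P (c+N) n‖ := by
      rw [P_prod, P_prod, norm_prod, norm_prod]
      refine Finset.prod_le_prod (fun _ _ => norm_nonneg _) fun j _ => ?_
      have hN' : (N₀:ℝ) ≤ N := by exact_mod_cast hN
      have hj : (0:ℝ) ≤ j := Nat.cast_nonneg j
      rw [Complex.norm_def, Complex.norm_def]
      apply Real.sqrt_le_sqrt
      simp only [Complex.normSq_apply, add_re, natCast_re, add_im, natCast_im]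
      nlinarith
    gcongr

lemma main {a b c : ℂ} (hc : ∀ n : ℕ, c ≠ -(n : ℂ)) (h : 0 < (c-a-b).re) :
    ∑' n, t a b c n = Gamma c * Gamma (c-a-b) / (Gamma (c-a) * Gamma (c-b)) := by
  have hd : ∀ n : ℕ, c-a-b ≠ -(n:ℂ) := by
    intro n hn
    rw [hn] at h
    simp at h
    linarith [Nat.cast_nonneg (α := ℝ) n]
  have zero : ∀ m : ℕ, (c - a = -(m:ℂ) ∨ c - b = -(m:ℂ)) → ∑' n, t a b c n = 0 := by
    intro m hm
    have := F_iter hc h (m+1)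
    have hz : P (c-a) (m+1) * P (c-b) (m+1) = 0 := by
      rcases hm with hm | hm <;> rw [hm, P_eq_zero m (m+1) (by omega)] <;> simp
    rw [hz, zero_mul] at this
    exact (mul_eq_zero.1 this).resolve_left (mul_ne_zero (P_ne hc _) (P_ne hd _))
  by_cases h1 : Gamma (c-a) = 0
  · obtain ⟨m, hm⟩ := (Gamma_eq_zero_iff _).1 h1
    rw [zero m (Or.inl hm), h1]; simp
  by_cases h2 : Gamma (c-b) = 0
  · obtain ⟨m, hm⟩ := (Gamma_eq_zero_iff _).1 h2
    rw [zero m (Or.inr hm), h2]; simp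
  have ha : ∀ n : ℕ, c-a ≠ -(n:ℂ) := fun n hn => h1 ((Gamma_eq_zero_iff _).2 ⟨n, hn⟩)
  have hb : ∀ n : ℕ, c-b ≠ -(n:ℂ) := fun n hn => h2 ((Gamma_eq_zero_iff _).2 ⟨n, hn⟩)
  have L := ((((GammaSeq_tendsto_Gamma c).mul (GammaSeq_tendsto_Gamma (c-a-b))).div
    ((GammaSeq_tendsto_Gamma (c-a)).mul (GammaSeq_tendsto_Gamma (c-b)))
    (mul_ne_zero h1 h2))).mul ((tendsto_add_atTop_iff_nat 1).2 (F_lim hc h))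
  rw [mul_one] at L
  refine tendsto_nhds_unique (tendsto_const_nhds.congr' ?_) L
  filter_upwards [eventually_gt_atTop 0] with n hn
  have hn' : (n:ℂ) ≠ 0 := by exact_mod_cast hn.ne'
  have hf : (n.factorial : ℂ) ≠ 0 := by exact_mod_cast n.factorial_ne_zero
  have e : (n:ℂ)^c * (n:ℂ)^(c-a-b) = (n:ℂ)^(c-a) * (n:ℂ)^(c-b) := by
    rw [← cpow_add _ _ hn', ← cpow_add _ _ hn']; congr 1; ring
  have q1 : (n:ℂ)^(c-a) ≠ 0 := by simp [cpow_eq_zero_iff, hn']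
  have q2 : (n:ℂ)^(c-b) ≠ 0 := by simp [cpow_eq_zero_iff, hn']
  have it := F_iter hc h (n+1)
  have p1 := P_ne hc (n+1)
  have p2 := P_ne hd (n+1)
  have p3 := P_ne ha (n+1)
  have p4 := P_ne hb (n+1)
  simp only [Pi.mul_apply, Pi.div_apply, seq_eq]
  have e3 : (n:ℂ)^c * n.factorial / P c (n+1) * ((n:ℂ)^(c-a-b) * n.factorial / P (c-a-b) (n+1))
      / ((n:ℂ)^(c-a) * n.factorial / P (c-a) (n+1) * ((n:ℂ)^(c-b) * n.factorial / P (c-b) (n+1)))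
      = P (c-a) (n+1) * P (c-b) (n+1) / (P c (n+1) * P (c-a-b) (n+1)) := by
    rw [div_mul_div_comm, div_mul_div_comm, div_div_div_eq, div_eq_div_iff (by positivity) (by positivity)]
    linear_combination (n.factorial:ℂ)^2 * P (c-a) (n+1) * P (c-b) (n+1) * P c (n+1) * P (c-a-b) (n+1) * e
  rw [e3, div_mul_eq_mul_div, eq_div_iff (mul_ne_zero p1 p2)]
  linear_combination it

end GaussAux

/-- Gauss summation formula: `₂F₁(a,b,c;1) = Γ(c)Γ(c−a−b)/(Γ(c−a)Γ(c−b))`. -/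
theorem gauss_hypergeometric_at_one (a b c : ℂ)
    (hc : ∀ n : ℕ, c ≠ -(n : ℂ)) (habc : 0 < (c - a - b).re) :
    ∑' n : ℕ,
        ((ascPochhammer ℂ n).eval a * (ascPochhammer ℂ n).eval b
          / (ascPochhammer ℂ n).eval c) / (n.factorial : ℂ)
      = Complex.Gamma c * Complex.Gamma (c - a - b)
        / (Complex.Gamma (c - a) * Complex.Gamma (c - b)) := by
  exact GaussAux.main hc habc
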